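/- arXiv:1601.02473 — 2 statements merged into one kernel-verified Lean document; each statement's English description precedes it below -/
import Mathlib

section
/- Let R be a commutative Noetherian local ring with maximal ideal m, residue field k, and Krull dimension d. Then the local cohomology modules H^i_m(M) vanish for all i > d and all R-modules M. -/
open CategoryTheory

namespace GV
universe u
variable {R : Type u} [CommRing R]

/-- Torsion elements with respect to powers of an ideal. -/
def Tors (I : Ideal R) {M : Type*} [AddCommGroup M] [Module R M] (e : M) : Prop :=
  ∃ n : ℕ, ∀ a ∈ I ^ n, a • e = 0

lemma Tors.sub {I : Ideal R} {M : Type*} [AddCommGroup M] [Module R M] {e f : M}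
    (he : Tors I e) (hf : Tors I f) : Tors I (e - f) := by
  obtain ⟨n, hn⟩ := he
  obtain ⟨m, hm⟩ := hf
  refine ⟨n + m, fun a ha => ?_⟩
  rw [smul_sub, hn a (Ideal.pow_le_pow_right (by omega) ha),
    hm a (Ideal.pow_le_pow_right (by omega) ha), sub_zero]

lemma Tors.smul {I : Ideal R} {M : Type*} [AddCommGroup M] [Module R M] {e : M}
    (he : Tors I e) (r : R) : Tors I (r • e) := by
  obtain ⟨n, hn⟩ := he
  exact ⟨n, fun a ha => by rw [smul_comm, hn a ha, smul_zero]⟩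

lemma Tors.map {I : Ideal R} {M N : Type*} [AddCommGroup M] [Module R M]
    [AddCommGroup N] [Module R N] {e : M} (φ : M →ₗ[R] N)
    (he : Tors I e) : Tors I (φ e) := by
  obtain ⟨n, hn⟩ := he
  exact ⟨n, fun a ha => by rw [← map_smul, hn a ha, map_zero]⟩

lemma exists_ann_stable [IsNoetherianRing R] (x : R) (n : ℕ) :
    ∃ k : ℕ, ∀ r : R, x ^ (n + k) * r = 0 → x ^ k * r = 0 := by
  obtain ⟨k, hk⟩ := monotone_stabilizes_iff_noetherian.mpr (inferInstanceAs (IsNoetherian R R))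
    (⟨fun k => LinearMap.ker (LinearMap.mulLeft R (x ^ k)), by
      intro a b hab r hr
      simp only [LinearMap.mem_ker, LinearMap.mulLeft_apply] at hr ⊢
      obtain ⟨c, rfl⟩ := Nat.exists_eq_add_of_le hab
      rw [pow_add, mul_right_comm, hr, zero_mul]⟩ : ℕ →o Submodule R R)
  refine ⟨k, fun r hr => ?_⟩
  have := hk (n + k) (by omega)
  have h2 : r ∈ LinearMap.ker (LinearMap.mulLeft R (x ^ (n + k))) := by simpa using hr
  have h3 : r ∈ LinearMap.ker (LinearMap.mulLeft R (x ^ k)) := by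
    change LinearMap.ker (LinearMap.mulLeft R (x ^ k)) =
      LinearMap.ker (LinearMap.mulLeft R (x ^ (n + k))) at this
    rw [this]; exact h2
  simpa using h3

lemma divis [IsNoetherianRing R] {E : Type u} [AddCommGroup E] [Module R E]
    (hE : Module.Injective R E) (I : Ideal R) (x : R) (n : ℕ) (g : E) (hg : Tors I g) :
    ∃ (g' : E) (k : ℕ), Tors I g' ∧ x ^ k • (g - x ^ n • g') = 0 := by
  obtain ⟨a, ha⟩ := hg
  obtain ⟨k, hk⟩ := exists_ann_stable x n
  obtain ⟨c, hc⟩ := Ideal.exists_pow_inf_eq_pow_smul I (Ideal.span {x ^ (n + k)} : Submodule R R)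
  set b := a + c
  have key : ∀ r : R, x ^ (n + k) * r ∈ I ^ b → r • (x ^ k • g) = 0 := by
    intro r hr
    have h1 : x ^ (n + k) * r ∈ (I ^ b • ⊤ ⊓ (Ideal.span {x ^ (n + k)} : Submodule R R)) := by
      refine ⟨by simpa using hr, ?_⟩
      exact Ideal.mul_mem_right _ _ (Ideal.mem_span_singleton_self _)
    rw [hc b (by omega)] at h1
    have h2 : x ^ (n + k) * r ∈ I ^ a * Ideal.span {x ^ (n + k)} := by
      have : I ^ (b - c) • (I ^ c • ⊤ ⊓ (Ideal.span {x ^ (n + k)} : Submodule R R)) ≤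
          I ^ a • (Ideal.span {x ^ (n + k)} : Submodule R R) := by
        rw [show b - c = a by omega]
        exact Submodule.smul_mono le_rfl inf_le_right
      exact this h1
    obtain ⟨s, hs, hs2⟩ := Ideal.mem_mul_span_singleton.mp h2
    have h3 : x ^ k * (r - s) = 0 := hk _ (by rw [mul_sub, ← hs2]; ring)
    have : r • x ^ k • g = (x ^ k * (r - s)) • g + x ^ k • s • g := by
      rw [mul_sub, sub_smul, mul_smul, mul_smul, smul_comm r]; abel
    rw [this, h3, ha s hs]; simp
  -- quotient ring Q = R / I^b, map R / ker → Q injective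
  let α : R →ₗ[R] (R ⧸ I ^ b) := (I ^ b).mkQ ∘ₗ LinearMap.mulLeft R (x ^ (n + k))
  let β : R →ₗ[R] E := LinearMap.toSpanSingleton R E (x ^ k • g)
  have hαβ : LinearMap.ker α ≤ LinearMap.ker β := by
    intro r hr
    simp only [α, β, LinearMap.mem_ker, LinearMap.comp_apply, LinearMap.mulLeft_apply,
      Submodule.mkQ_apply, Submodule.Quotient.mk_eq_zero] at hr ⊢
    simpa using key r hr
  obtain ⟨h, hh⟩ := hE.out ((LinearMap.ker α).liftQ α le_rfl)
    (LinearMap.ker_eq_bot.mp (Submodule.ker_liftQ_eq_bot _ _ _ le_rfl))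
    ((LinearMap.ker α).liftQ β hαβ)
  refine ⟨h ((I ^ b).mkQ 1), k, ⟨b, fun y hy => ?_⟩, ?_⟩
  · rw [← map_smul, ← map_smul]
    simp only [smul_eq_mul, mul_one]
    rw [(Submodule.Quotient.mk_eq_zero (p := I ^ b)).mpr hy |> (fun h => show (I^b).mkQ y = 0 from h), map_zero]
  · have := hh ((LinearMap.ker α).mkQ 1)
    simp only [Submodule.mkQ_apply, Submodule.liftQ_apply] at this
    have hα : α 1 = (x ^ (n + k)) • (I ^ b).mkQ 1 := by
      rw [← map_smul]; simp [α]
    rw [hα, map_smul] at this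
    rw [smul_sub, ← mul_smul, ← pow_add, add_comm k n, this]
    simp [β]

/-- The ambient injective module. -/
noncomputable abbrev E (M : ModuleCat.{u} R) : ModuleCat.{u} R := Injective.under M

noncomputable abbrev j (M : ModuleCat.{u} R) : M ⟶ E M := Injective.ι M

/-- The first cosyzygy. -/
noncomputable def C (M : ModuleCat.{u} R) : ModuleCat.{u} R :=
  ModuleCat.of R (E M ⧸ LinearMap.range (j M).hom)

noncomputable def p (M : ModuleCat.{u} R) : E M ⟶ C M :=
  ModuleCat.ofHom (LinearMap.range (j M).hom).mkQ

lemma j_inj (M : ModuleCat.{u} R) : Function.Injective (j M).hom :=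
  (ModuleCat.mono_iff_injective _).mp inferInstance

lemma p_surj (M : ModuleCat.{u} R) : Function.Surjective (p M).hom :=
  Submodule.mkQ_surjective _

lemma p_eq_zero (M : ModuleCat.{u} R) (e : E M) : (p M).hom e = 0 ↔ ∃ m, (j M).hom m = e := by
  change Submodule.Quotient.mk e = (0 : E M ⧸ LinearMap.range (j M).hom) ↔ _
  rw [Submodule.Quotient.mk_eq_zero]; rfl

lemma E_inj (M : ModuleCat.{u} R) : Module.Injective R (E M) :=
  (Module.injective_iff_injective_object R (E M)).mpr (inferInstanceAs (Injective (E M)))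

def Surj (I : Ideal R) (M : ModuleCat.{u} R) : Prop :=
  ∀ c : C M, Tors I c → ∃ f : E M, Tors I f ∧ (p M).hom f = c

lemma surj_step [IsNoetherianRing R] (I : Ideal R) (x : R) (M : ModuleCat.{u} R)
    (h1 : Surj I M) (h2 : Surj I (C M)) : Surj (I ⊔ Ideal.span {x}) (C M) := by
  rintro c ⟨t, ht⟩
  obtain ⟨f, hf, hfc⟩ := h2 c ⟨t, fun a ha => ht a (Ideal.pow_right_mono le_sup_left t ha)⟩
  have hx : x ^ t • c = 0 := ht _ (Ideal.pow_mem_pow (Ideal.mem_sup_right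
    (Ideal.mem_span_singleton_self x)) t)
  obtain ⟨m, hm⟩ := (p_eq_zero (C M) (x ^ t • f)).mp (by rw [map_smul, hfc, hx])
  have hmt : Tors I m := by
    obtain ⟨n, hn⟩ := hf.smul (x ^ t)
    refine ⟨n, fun a ha => j_inj _ ?_⟩
    rw [map_smul, map_zero, hm, hn a ha]
  obtain ⟨g, hg, hgm⟩ := h1 m hmt
  obtain ⟨g', k, hg', hk⟩ := divis (E_inj M) I x t g hg
  have hT : Tors I (f - (j (C M)).hom ((p M).hom g')) :=
    hf.sub ((hg'.map (p M).hom).map (j (C M)).hom)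
  refine ⟨f - (j (C M)).hom ((p M).hom g'), ?_, ?_⟩
  · obtain ⟨n, hn⟩ := hT
    have hz : x ^ (k + t) • (f - (j (C M)).hom ((p M).hom g')) = 0 := by
      rw [pow_add, mul_smul, smul_sub (x ^ t), ← hm, ← hgm, ← map_smul, ← map_smul, ← map_sub,
        ← map_sub, ← map_smul, ← map_smul, hk, map_zero, map_zero]
    refine ⟨n + (k + t), fun a ha => ?_⟩
    have := Ideal.sup_pow_add_le_pow_sup_pow ha
    rw [Ideal.span_singleton_pow] at this
    obtain ⟨y, hy, z, hz', rfl⟩ := Submodule.mem_sup.mp this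
    obtain ⟨w, rfl⟩ := Ideal.mem_span_singleton'.mp hz'
    rw [add_smul, hn y hy, mul_smul, hz, smul_zero, zero_add]
  · rw [map_sub, hfc, (p_eq_zero _ _).mpr ⟨_, rfl⟩, sub_zero]

lemma surj_finset [IsNoetherianRing R] (n : ℕ) : ∀ (s : Finset R), s.card = n →
    ∀ N : ModuleCat.{u} R, Surj (Ideal.span (s : Set R)) (C^[n] N) := by
  classical
  induction n with
  | zero =>
    intro s hs N c _
    obtain rfl := Finset.card_eq_zero.mp hs
    obtain ⟨f, hf⟩ := p_surj _ c
    refine ⟨f, ⟨1, fun a ha => ?_⟩, hf⟩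
    have ha : a = 0 := by simpa using ha
    rw [ha]
    exact zero_smul R f
  | succ n ih =>
    intro s hs N
    obtain ⟨x, s', hx, rfl, hs'⟩ := Finset.card_eq_succ.mp hs
    have h1 := ih s' hs' N
    have h2 := ih s' hs' (C N)
    rw [← Function.iterate_succ_apply, Function.iterate_succ_apply'] at h2
    rw [Function.iterate_succ_apply', Finset.coe_insert, Set.insert_eq, Ideal.span_union, sup_comm]
    exact surj_step _ _ _ h1 h2

lemma surj_main [IsNoetherianRing R] [IsLocalRing R] (d : ℕ) (hd : ringKrullDim R = d)
    (N : ModuleCat.{u} R) : Surj (IsLocalRing.maximalIdeal R) (C^[d] N) := by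
  obtain ⟨s, hs, hc⟩ :=
    (IsLocalRing.maximalIdeal R).exists_finset_card_eq_height_of_isNoetherianRing
  have hh : s.card = d := by
    have := IsLocalRing.maximalIdeal_height_eq_ringKrullDim (R := R)
    rw [hd, ← hc] at this
    exact_mod_cast this
  have hle : Ideal.span (s : Set R) ≤ IsLocalRing.maximalIdeal R := hs.1.2
  have hrad : IsLocalRing.maximalIdeal R ≤ (Ideal.span (s : Set R)).radical := by
    rw [Ideal.radical_eq_sInf]
    refine le_sInf ?_
    rintro q ⟨hq, hqp⟩
    exact hs.2 ⟨hqp, hq⟩ (IsLocalRing.le_maximalIdeal hqp.ne_top)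
  obtain ⟨k, hk⟩ := Ideal.exists_pow_le_of_le_radical_of_fg hrad (IsNoetherian.noetherian _)
  rintro c ⟨t, ht⟩
  obtain ⟨f, ⟨n, hn⟩, hf⟩ := surj_finset d s hh N c
    ⟨t, fun a ha => ht a (Ideal.pow_right_mono hle t ha)⟩
  refine ⟨f, ⟨k * n, fun a ha => hn a ?_⟩, hf⟩
  rw [pow_mul] at ha
  exact Ideal.pow_right_mono hk n ha

end GV
namespace GV
universe u
variable {R : Type u} [CommRing R]
open Opposite Limits

lemma ext_rep {X : ModuleCat.{u} R} (P : ProjectiveResolution X) (Y : ModuleCat.{u} R) (n : ℕ)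
    (ξ : ((Ext R (ModuleCat.{u} R) (n + 1)).obj (op X)).obj Y) :
    ∃ f : P.complex.X (n + 1) ⟶ Y, P.complex.d (n + 2) (n + 1) ≫ f = 0 ∧
      ∀ (X' : ModuleCat.{u} R) (g : X' ⟶ X) (P' : ProjectiveResolution X')
        (θ : P'.complex.X n ⟶ Y),
        (ProjectiveResolution.lift g P' P).f (n + 1) ≫ f = P'.complex.d (n + 1) n ≫ θ →
        (((Ext R (ModuleCat.{u} R) (n + 1)).map g.op).app Y).hom ξ = 0 := by
  let F := ((linearYoneda R (ModuleCat.{u} R)).obj Y).rightOp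
  let K := (F.mapHomologicalComplex (ComplexShape.down ℕ)).obj P.complex
  let ξ' : (unop (K.homology (n + 1)) : ModuleCat R) :=
    (P.isoLeftDerivedObj F (n + 1)).inv.unop.hom ξ
  obtain ⟨o, ho⟩ := (ModuleCat.epi_iff_surjective (K.homologyι (n + 1)).unop).mp inferInstance ξ'
  let f : P.complex.X (n + 1) ⟶ Y := (K.pOpcycles (n + 1)).unop.hom o
  refine ⟨f, ?_, ?_⟩
  · have h := K.d_pOpcycles (n + 2) (n + 1)
    have h2 := congrArg (fun q => q.unop.hom o) h
    exact h2
  · intro X' g P' θ hθ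
    let K' := (F.mapHomologicalComplex (ComplexShape.down ℕ)).obj P'.complex
    let φ := ProjectiveResolution.lift g P' P
    let Φ : K' ⟶ K := (F.mapHomologicalComplex (ComplexShape.down ℕ)).map φ
    have e1 := F.leftDerived_map_eq (n + 1) g φ (ProjectiveResolution.lift_commutes g P' P)
    have e2 : (((Ext R (ModuleCat.{u} R) (n + 1)).map g.op).app Y).hom ξ =
      ((F.leftDerived (n + 1)).map g).unop.hom ξ := rfl
    have e3 : ((F.leftDerived (n + 1)).map g).unop.hom ξ =
      (P'.isoLeftDerivedObj F (n + 1)).hom.unop.hom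
        ((HomologicalComplex.homologyMap Φ (n + 1)).unop.hom ξ') := by
      rw [e1]; rfl
    have e4 : (HomologicalComplex.opcyclesMap Φ (n + 1)).unop.hom o =
        (K'.fromOpcycles (n + 1) n).unop.hom θ := by
      apply (ModuleCat.mono_iff_injective (K'.pOpcycles (n + 1)).unop).mp inferInstance
      have h1 := congrArg (fun q => q.unop.hom o) (HomologicalComplex.p_opcyclesMap Φ (n + 1))
      have h2 := congrArg (fun q => q.unop.hom θ) (K'.p_fromOpcycles (n + 1) n)
      refine Eq.trans h1 (Eq.trans ?_ h2.symm)
      exact hθ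
    have e5 : (HomologicalComplex.homologyMap Φ (n + 1)).unop.hom ξ' = 0 := by
      rw [← ho]
      have h1 := congrArg (fun q => q.unop.hom o) (HomologicalComplex.homologyι_naturality Φ (n + 1))
      refine Eq.trans h1 ?_
      have h2 := congrArg (fun q => q.unop.hom θ) (K'.homologyι_comp_fromOpcycles (n + 1) n)
      refine Eq.trans ?_ h2
      exact congrArg (fun z => (K'.homologyι (n + 1)).unop.hom z) e4
    refine e2.trans (e3.trans ?_)
    exact (congrArg (P'.isoLeftDerivedObj F (n + 1)).hom.unop.hom e5).trans (map_zero _)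

/-- The quotient `R / I ^ t`. -/
noncomputable abbrev X (I : Ideal R) (t : ℕ) : ModuleCat.{u} R :=
  (localCohomology.ringModIdeals (localCohomology.idealPowersDiagram I)).obj (op t)

noncomputable abbrev tr (I : Ideal R) {t s : ℕ} (h : t ≤ s) : X I s ⟶ X I t :=
  (localCohomology.ringModIdeals (localCohomology.idealPowersDiagram I)).map (homOfLE h).op

noncomputable abbrev P (I : Ideal R) (t : ℕ) : ProjectiveResolution (X I t) :=
  projectiveResolution (X I t)

noncomputable abbrev φ (I : Ideal R) {t s : ℕ} (h : t ≤ s) : (P I s).complex ⟶ (P I t).complex :=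
  ProjectiveResolution.lift (tr I h) (P I s) (P I t)

/-- Every Ext class in degree `n + 1` dies further along the system. -/
def Dies (I : Ideal R) (M : ModuleCat.{u} R) (n : ℕ) : Prop :=
  ∀ (t : ℕ) (f : (P I t).complex.X (n + 1) ⟶ M), (P I t).complex.d (n + 2) (n + 1) ≫ f = 0 →
    ∃ (s : ℕ) (h : t ≤ s) (θ : (P I s).complex.X n ⟶ M),
      (φ I h).f (n + 1) ≫ f = (P I s).complex.d (n + 1) n ≫ θ

lemma j_p (M : ModuleCat.{u} R) : j M ≫ p M = 0 := by
  ext m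
  exact (p_eq_zero M _).mpr ⟨m, rfl⟩

instance (M : ModuleCat.{u} R) : Epi (p M) := (ModuleCat.epi_iff_surjective _).mpr (p_surj M)

lemma jp_exact (M : ModuleCat.{u} R) : (ShortComplex.mk _ _ (j_p M)).Exact := by
  rw [ShortComplex.moduleCat_exact_iff]
  intro x hx
  exact (p_eq_zero M x).mp hx

lemma extend (I : Ideal R) (M : ModuleCat.{u} R) (n t : ℕ) (f : (P I t).complex.X (n + 1) ⟶ M)
    (hf : (P I t).complex.d (n + 2) (n + 1) ≫ f = 0) :
    ∃ η : (P I t).complex.X n ⟶ E M, (P I t).complex.d (n + 1) n ≫ η = f ≫ j M :=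
  ⟨((P I t).exact_succ n).descToInjective (f ≫ j M)
    (by rw [← Category.assoc]; exact (congrArg (fun q => q ≫ j M) hf).trans (by simp)),
    ((P I t).exact_succ n).comp_descToInjective _ _⟩

lemma finish (I : Ideal R) (M : ModuleCat.{u} R) (n t s : ℕ) (h : t ≤ s)
    (f : (P I t).complex.X (n + 1) ⟶ M)
    (η : (P I t).complex.X n ⟶ E M) (hη : (P I t).complex.d (n + 1) n ≫ η = f ≫ j M)
    (ρ : (P I s).complex.X n ⟶ E M) (hρ : (P I s).complex.d (n + 1) n ≫ ρ = 0)
    (e : (φ I h).f n ≫ η ≫ p M = ρ ≫ p M) :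
    ∃ θ : (P I s).complex.X n ⟶ M,
      (φ I h).f (n + 1) ≫ f = (P I s).complex.d (n + 1) n ≫ θ := by
  have hz : ((φ I h).f n ≫ η - ρ) ≫ p M = 0 := by
    rw [Preadditive.sub_comp, Category.assoc, e, sub_self]
  have hθ := (jp_exact M).liftFromProjective_comp ((φ I h).f n ≫ η - ρ) hz
  refine ⟨(jp_exact M).liftFromProjective ((φ I h).f n ≫ η - ρ) hz, ?_⟩
  rw [← cancel_mono (j M), Category.assoc, Category.assoc]
  erw [hθ]
  rw [Preadditive.comp_sub, hρ, sub_zero, ← hη, ← Category.assoc, ← Category.assoc,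
    HomologicalComplex.Hom.comm]

lemma dies_succ (I : Ideal R) (M : ModuleCat.{u} R) (n : ℕ) (hM : Dies I (C M) n) :
    Dies I M (n + 1) := by
  intro t f hf
  obtain ⟨η, hη⟩ := extend I M (n + 1) t f hf
  obtain ⟨s, h, θ, hθ⟩ := hM t (η ≫ p M) (by
    rw [← Category.assoc, hη, Category.assoc, j_p, comp_zero])
  obtain ⟨θ', hθ'⟩ : ∃ θ' : (P I s).complex.X n ⟶ E M, θ' ≫ p M = θ :=
    ⟨Projective.factorThru θ (p M), Projective.factorThru_comp _ _⟩
  refine ⟨s, h, finish I M (n + 1) t s h f η hη ((P I s).complex.d (n + 1) n ≫ θ') (by simp) ?_⟩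
  rw [hθ, Category.assoc, hθ']

/-- The map out of `R / I ^ t` given by an element killed by `I ^ t`. -/
noncomputable def ofElt (I : Ideal R) (t : ℕ) (N : ModuleCat.{u} R) (c : N)
    (hc : ∀ a ∈ I ^ t, a • c = 0) : X I t ⟶ N :=
  ModuleCat.ofHom (Submodule.liftQ (I ^ t) (LinearMap.toSpanSingleton R N c) (by
    intro a ha; exact hc a ha))

/-- The augmentation. -/
noncomputable def ε (I : Ideal R) (t : ℕ) : (P I t).complex.X 0 ⟶ X I t := (P I t).π.f 0

lemma d_ε (I : Ideal R) (t : ℕ) : (P I t).complex.d 1 0 ≫ ε I t = 0 :=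
  (P I t).complex_d_comp_π_f_zero

lemma φ_ε (I : Ideal R) {t s : ℕ} (h : t ≤ s) : (φ I h).f 0 ≫ ε I t = ε I s ≫ tr I h :=
  ProjectiveResolution.lift_commutes_zero (tr I h) (P I s) (P I t)

lemma dies_zero (I : Ideal R) (M : ModuleCat.{u} R) (hM : Surj I M) : Dies I M 0 := by
  intro t f hf
  obtain ⟨η, hη⟩ := extend I M 0 t f hf
  have hz : (P I t).complex.d 1 0 ≫ η ≫ p M = 0 := by
    rw [← Category.assoc, hη, Category.assoc, j_p, comp_zero]
  obtain ⟨γ, hγ⟩ : ∃ γ : X I t ⟶ C M, ε I t ≫ γ = η ≫ p M :=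
    ⟨(P I t).isColimitCokernelCofork.desc (CokernelCofork.ofπ _ hz),
      (P I t).isColimitCokernelCofork.fac (CokernelCofork.ofπ _ hz) WalkingParallelPair.one⟩
  let one (s : ℕ) : X I s := (Submodule.Quotient.mk (1 : R) : R ⧸ I ^ s)
  have hone (s : ℕ) (a : R) (ha : a ∈ I ^ s) : a • one s = 0 := by
    change (Submodule.Quotient.mk (a • (1 : R)) : R ⧸ I ^ s) = 0
    rw [Submodule.Quotient.mk_eq_zero]; simpa using ha
  obtain ⟨e, ⟨s₀, hs₀⟩, he⟩ := hM (γ.hom (one t)) ⟨t, fun a ha => by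
    rw [← map_smul, hone t a ha, map_zero]⟩
  let s := max t s₀
  have h : t ≤ s := le_max_left _ _
  let δ : X I s ⟶ E M := ofElt I s (E M) e
    (fun a ha => hs₀ a (Ideal.pow_le_pow_right (le_max_right _ _) ha))
  have hδ : tr I h ≫ γ = δ ≫ p M := by
    ext x
    obtain ⟨r, rfl⟩ := Submodule.Quotient.mk_surjective (I ^ s) x
    change γ.hom (Submodule.Quotient.mk r : R ⧸ I ^ t) = (p M).hom (r • e)
    rw [map_smul, he, ← map_smul]
    congr 1
    change _ = (Submodule.Quotient.mk (r • (1 : R)) : R ⧸ I ^ t)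
    simp
  refine ⟨s, h, finish I M 0 t s h f η hη (ε I s ≫ δ) ?_ ?_⟩
  · have := d_ε I s
    rw [← Category.assoc, this, zero_comp]
  · rw [← hγ, Category.assoc, ← hδ, ← Category.assoc, φ_ε, Category.assoc]

lemma dies_main (I : Ideal R) (n : ℕ) : ∀ (M : ModuleCat.{u} R), Surj I (C^[n] M) →
    Dies I M n := by
  induction n with
  | zero => exact fun M h => dies_zero I M h
  | succ n ih => exact fun M h => dies_succ I M n (ih _ h)

lemma vanish (I : Ideal R) (n : ℕ) (M : ModuleCat.{u} R) (h : Dies I M n) :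
    Subsingleton ((localCohomology I (n + 1)).obj M) := by
  let D := localCohomology.diagram (localCohomology.idealPowersDiagram I) (n + 1)
  let ev := (evaluation (ModuleCat.{u} R) (ModuleCat.{u} R)).obj M
  have hc : IsColimit (ev.mapCocone (colimit.cocone D)) := 
    isColimitOfPreserves ev (colimit.isColimit D)
  have key : ∀ t, (ev.mapCocone (colimit.cocone D)).ι.app t = 0 := by
    intro t
    ext ξ
    obtain ⟨f, hf, H⟩ := ext_rep (P I t.unop.unop) M n ξ
    obtain ⟨s, hs, θ, hθ⟩ := h t.unop.unop f hf
    have hzero := H _ (tr I hs) (P I s) θ hθ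
    have hw := (ev.mapCocone (colimit.cocone D)).w (homOfLE hs).op.op
    rw [← hw]
    exact (congrArg (((ev.mapCocone (colimit.cocone D)).ι.app (op (op s))).hom) hzero).trans
      (map_zero _)
  have hid : 𝟙 (ev.mapCocone (colimit.cocone D)).pt = 0 :=
    hc.hom_ext (fun t => by rw [key t, zero_comp, zero_comp])
  exact ModuleCat.subsingleton_of_isZero ((IsZero.iff_id_eq_zero _).mpr hid)

end GV

/-- **Grothendieck vanishing.** Let `R` be a commutative Noetherian local
ring with maximal ideal `m` and Krull dimension `d`. Then the local cohomology modules
`H^i_m(M)` vanish for all `i > d` and all `R`-modules `M`. -/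
theorem stmt1 {R : Type u} [CommRing R] [IsNoetherianRing R] [IsLocalRing R]
    (d : ℕ) (hd : ringKrullDim R = d) :
    ∀ i : ℕ, d < i → ∀ M : ModuleCat.{u} R,
      Subsingleton ((localCohomology (IsLocalRing.maximalIdeal R) i).obj M) := by
  intro i hi M
  obtain ⟨k, rfl⟩ := Nat.exists_eq_add_of_lt hi
  refine GV.vanish _ _ M (GV.dies_main _ _ M ?_)
  rw [Function.iterate_add_apply]
  exact GV.surj_main d hd _
end

section
/- Let R be a commutative Noetherian ring, I an ideal, and M a finitely generated R-module with IM ≠ M. If e = depth_I(M) is the I-depth of M, then H^i_I(M) = 0 for all i < e, and H^e_I(M) ≠ 0. -/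
open CategoryTheory RingTheory.Sequence
universe u

namespace DepthLC

open Limits

lemma mono_homologyMap {R : Type u} [Ring R] {S₁ S₂ : ShortComplex (ModuleCat.{u} R)} (φ : S₁ ⟶ S₂)
    (h : ∀ x : S₁.X₂, S₁.g.hom x = 0 → (∃ y, S₂.f.hom y = φ.τ₂.hom x) → ∃ y, S₁.f.hom y = x) :
    Mono (ShortComplex.homologyMap φ) := by
  rw [ModuleCat.mono_iff_injective]
  rw [← LinearMap.ker_eq_bot, LinearMap.ker_eq_bot']
  intro z hz
  obtain ⟨c, rfl⟩ := (ModuleCat.epi_iff_surjective S₁.homologyπ).1 inferInstance z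
  have hπ : ∀ (S : ShortComplex (ModuleCat.{u} R)) (c : S.cycles),
      S.homologyπ.hom c = 0 ↔ ∃ y, S.f.hom y = S.iCycles.hom c := by
    intro S c
    have h1 : S.homologyπ.hom c = 0 ↔ S.pOpcycles.hom (S.iCycles.hom c) = 0 := by
      have e : S.homologyι.hom (S.homologyπ.hom c) = S.pOpcycles.hom (S.iCycles.hom c) := by
        have := S.homology_π_ι
        exact LinearMap.congr_fun (congrArg ModuleCat.Hom.hom (this)) c
      rw [← e]
      constructor
      · intro h; rw [h, map_zero]
      · intro h
        exact (ModuleCat.mono_iff_injective S.homologyι).1 inferInstance (h.trans (map_zero _).symm)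
    rw [h1]
    exact ShortComplex.moduleCat_pOpcycles_eq_zero_iff _ _
  refine (hπ _ c).2 (h _ ?_ ?_)
  · exact LinearMap.congr_fun (congrArg ModuleCat.Hom.hom (S₁.iCycles_g)) c
  · have h2 : S₂.homologyπ.hom ((ShortComplex.cyclesMap φ).hom c) = 0 := by
      have := ShortComplex.homologyπ_naturality φ
      have := LinearMap.congr_fun (congrArg ModuleCat.Hom.hom (this)) c
      exact this.symm.trans hz
    obtain ⟨y, hy⟩ := (hπ _ _).1 h2
    refine ⟨y, hy.trans ?_⟩
    exact LinearMap.congr_fun (congrArg ModuleCat.Hom.hom (ShortComplex.cyclesMap_i φ)) c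

section
open CochainComplex HomComplex
variable {R : Type u} [CommRing R] {X Y : ModuleCat.{u} R} (P : ProjectiveResolution X)

lemma extMk_eq_zero_iff' {n : ℕ} (f : P.complex.X n ⟶ Y) (hf : P.complex.d (n + 1) n ≫ f = 0) :
    P.extMk f (n + 1) rfl hf = 0 ↔
      ∃ g : P.complex.X ((ComplexShape.up ℕ).prev n) ⟶ Y,
        P.complex.d n ((ComplexShape.up ℕ).prev n) ≫ g = f := by
  rcases n with _ | n
  · simp only [← P.extEquivCohomologyClass.apply_eq_iff_eq,
      ProjectiveResolution.extEquivCohomologyClass_extMk,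
      ProjectiveResolution.extEquivCohomologyClass_zero,
      CohomologyClass.mk_eq_zero_iff]
    rw [Cocycle.toSingleMk_mem_coboundaries_iff _ _ _ _ _ 1 (by simp)]
    have h1 : IsZero (P.cochainComplex.X 1) := by
      apply P.cochainComplex.isZero_of_isStrictlyLE 0 1
    have h2 : P.complex.d 0 ((ComplexShape.up ℕ).prev 0) = 0 :=
      P.complex.shape _ _ (by simp)
    constructor
    · rintro ⟨g, hg⟩
      refine ⟨0, ?_⟩
      rw [h1.eq_of_src g 0, comp_zero] at hg
      rw [← cancel_epi (P.cochainComplexXIso (-(0:ℕ)) 0 rfl).hom, ← hg]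
      simp
    · rintro ⟨g, hg⟩
      refine ⟨0, ?_⟩
      rw [← hg, h2]
      simp
  · rw [P.extMk_eq_zero_iff f (n + 1 + 1) rfl hf ((ComplexShape.up ℕ).prev (n + 1)) (by simp)]

lemma isZero_iff_sub (A : ModuleCat.{u} R) : Subsingleton A ↔ IsZero A :=
  ⟨fun _ => ModuleCat.isZero_of_subsingleton A, ModuleCat.subsingleton_of_isZero⟩

lemma subsingleton_iff (n : ℕ) :
    Subsingleton (((_root_.Ext R (ModuleCat.{u} R) n).obj (Opposite.op X)).obj Y) ↔
      Subsingleton (Abelian.Ext X Y n) := by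
  let P := projectiveResolution X
  rw [isZero_iff_sub, (P.isoExt n Y).isZero_iff,
    ← HomologicalComplex.exactAt_iff_isZero_homology, HomologicalComplex.exactAt_iff,
    ShortComplex.moduleCat_exact_iff]
  have hn : (ComplexShape.up ℕ).next n = n + 1 := by simp
  have key : ∀ f : P.complex.X n ⟶ Y, P.complex.d ((ComplexShape.up ℕ).next n) n ≫ f = 0 ↔
      P.complex.d (n + 1) n ≫ f = 0 := by rw [hn]; intro f; rfl
  constructor
  · intro h
    refine subsingleton_of_forall_eq 0 fun y => ?_
    obtain ⟨f, hf, rfl⟩ := P.extMk_surjective y (n + 1) rfl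
    rw [extMk_eq_zero_iff']
    exact h f ((key f).2 hf)
  · intro h f hf
    exact (extMk_eq_zero_iff' P f ((key f).1 hf)).1 (Subsingleton.elim _ _)

lemma epi_homologyMap_op {K L : CochainComplex (ModuleCat.{u} R) ℕ} (ψ : K ⟶ L) (n : ℕ)
    (h : Mono (HomologicalComplex.homologyMap ψ n)) :
    Epi (HomologicalComplex.homologyMap ((HomologicalComplex.opFunctor _ _).map ψ.op) n) := by
  have e := HomologicalComplex.homologyOp_hom_naturality ψ n
  have h1 : Epi ((HomologicalComplex.homologyOp L n).hom ≫
      (HomologicalComplex.homologyMap ψ n).op) := by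
    infer_instance
  rw [← e] at h1
  have e3 : HomologicalComplex.homologyMap ((HomologicalComplex.opFunctor _ _).map ψ.op) n =
    (HomologicalComplex.homologyMap ((HomologicalComplex.opFunctor _ _).map ψ.op) n ≫
      (HomologicalComplex.homologyOp K n).hom) ≫ (HomologicalComplex.homologyOp K n).inv :=
    ((Category.assoc _ _ _).trans ((congrArg _ (Iso.hom_inv_id _)).trans (Category.comp_id _))).symm
  rw [e3]
  exact @epi_comp _ _ _ _ _ _ h1 _
    (@IsIso.epi_of_iso _ _ _ _ _ (Iso.isIso_inv (HomologicalComplex.homologyOp K n)))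

lemma old_ext_map_injective {X X' : ModuleCat.{u} R} (f : X' ⟶ X) (Y : ModuleCat.{u} R) (n : ℕ)
    (h : ∀ x : Abelian.Ext X Y n, (Abelian.Ext.mk₀ f).comp x (zero_add n) = 0 → x = 0) :
    Mono (((_root_.Ext R (ModuleCat.{u} R) n).map f.op).app Y) := by
  let P := projectiveResolution X
  let P' := projectiveResolution X'
  let φ : P'.complex ⟶ P.complex := ProjectiveResolution.lift f P' P
  let Φ : ProjectiveResolution.Hom P' P f := ⟨φ, by simpa [φ] using ProjectiveResolution.lift_commutes_zero f P' P⟩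
  let F := ((linearYoneda R (ModuleCat.{u} R)).obj Y).rightOp
  suffices H : Epi ((F.leftDerived n).map f) by
    change Mono ((F.leftDerived n).map f).unop
    infer_instance
  rw [Functor.leftDerived_map_eq F n f φ (ProjectiveResolution.lift_commutes f P' P)]
  suffices H : Epi (HomologicalComplex.homologyMap ((F.mapHomologicalComplex _).map φ) n) by
    have : Epi ((F.mapHomologicalComplex _ ⋙
      HomologicalComplex.homologyFunctor _ (ComplexShape.down ℕ) n).map φ) := H
    infer_instance
  let ψ : P.complex.linearYonedaObj R Y ⟶ P'.complex.linearYonedaObj R Y :=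
    (HomologicalComplex.unopFunctor _ _).map ((F.mapHomologicalComplex _).map φ).op
  have hψ : Mono (HomologicalComplex.homologyMap ψ n) := by
    apply mono_homologyMap
    have hn : (ComplexShape.up ℕ).next n = n + 1 := by simp
    have key : ∀ f : P.complex.X n ⟶ Y, P.complex.d ((ComplexShape.up ℕ).next n) n ≫ f = 0 ↔
      P.complex.d (n + 1) n ≫ f = 0 := by rw [hn]; intro f; rfl
    intro x hx hy
    have hx' := (key x).1 hx
    refine (extMk_eq_zero_iff' P x hx').1 (h _ ?_)
    rw [ProjectiveResolution.mk₀_comp_extMk x (n + 1) rfl hx' Φ]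
    exact (extMk_eq_zero_iff' P' _ _).2 hy
  exact epi_homologyMap_op ψ n hψ

lemma support_quot_le (I J : Ideal R) (t : ℕ) (h : I ^ t ≤ J) (N : Type u) [AddCommGroup N] [Module R N]
    [Module.Finite R N] (hN : J ≤ Module.annihilator R N) :
    Module.support R N ⊆ PrimeSpectrum.zeroLocus I := by
  rw [Module.support_eq_zeroLocus, PrimeSpectrum.zeroLocus_subset_zeroLocus_iff]
  intro x hx
  exact ⟨t, hN (h (Ideal.pow_mem_pow hx t))⟩

lemma new_ext_inj {A B M : ModuleCat.{u} R} (g : A ⟶ B) [Epi g] (e : ℕ)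
    (h : ∀ i < e, Subsingleton (Abelian.Ext (kernel g) M i)) (x : Abelian.Ext B M e)
    (hx : (Abelian.Ext.mk₀ g).comp x (zero_add e) = 0) : x = 0 := by
  have hS : (ShortComplex.mk (kernel.ι g) g (by simp)).ShortExact :=
    { exact := ShortComplex.exact_kernel g }
  rcases e with _ | e
  · apply Abelian.Ext.precomp_mk₀_injective_of_epi M g
    simpa using hx
  · obtain ⟨y, rfl⟩ := Abelian.Ext.contravariant_sequence_exact₃ hS M x hx (n₀ := e) (by omega)
    have := h e (by omega)
    rw [Subsingleton.elim y 0]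
    simp

lemma kernel_finite {A B : ModuleCat.{u} R} (g : A ⟶ B) [IsNoetherian R A] :
    Module.Finite R (kernel g : ModuleCat.{u} R) ∧
      Module.annihilator R A ≤ Module.annihilator R (kernel g : ModuleCat.{u} R) := by
  have hki : Function.Injective (kernel.ι g).hom :=
    (ModuleCat.mono_iff_injective (kernel.ι g)).1 inferInstance
  exact ⟨Module.Finite.of_injective (kernel.ι g).hom hki,
    LinearMap.annihilator_le_of_injective (kernel.ι g).hom hki⟩

end

open Opposite in
lemma depth_main {R : Type u} [CommRing R] [IsNoetherianRing R]
    (I : Ideal R) (M : Type u) [AddCommGroup M] [Module R M] [Module.Finite R M]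
    (hIM : I • (⊤ : Submodule R M) ≠ ⊤)
    (e : ℕ)
    (hex : ∃ rs : List R, rs.length = e ∧ (∀ r ∈ rs, r ∈ I) ∧ IsRegular M rs)
    (hmax : ∀ rs : List R, (∀ r ∈ rs, r ∈ I) → IsRegular M rs → rs.length ≤ e) :
    (∀ i : ℕ, i < e →
        Subsingleton ((localCohomology I i).obj (ModuleCat.of R M))) ∧
      Nontrivial ((localCohomology I e).obj (ModuleCat.of R M)) := by
  obtain ⟨rs, hlen, hrs, hreg⟩ := hex
  have van : ∀ (N : ModuleCat.{u} R) [Module.Finite R N] (t : ℕ),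
      I ^ t ≤ Module.annihilator R N → ∀ i < e, Subsingleton (Abelian.Ext N (ModuleCat.of R M) i) := by
    intro N _ t ht i hi
    exact ModuleCat.subsingleton_ext_of_exists_isRegular I N
      (support_quot_le I (I ^ t) t le_rfl N ht) (ModuleCat.of R M) (lt_top_iff_ne_top.2 hIM)
      rs hrs hreg i (hlen ▸ hi)
  let D (i : ℕ) : (ℕᵒᵖ)ᵒᵖ ⥤ ModuleCat.{u} R :=
    localCohomology.diagram (localCohomology.idealPowersDiagram I) i ⋙
      (evaluation _ _).obj (ModuleCat.of R M)
  let iso (i : ℕ) : (localCohomology I i).obj (ModuleCat.of R M) ≅ colimit (D i) :=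
    colimitObjIsoColimitCompEvaluation
      (localCohomology.diagram (localCohomology.idealPowersDiagram I) i) (ModuleCat.of R M)
  constructor
  · intro i hi
    rw [isZero_iff_sub, (iso i).isZero_iff, IsZero.iff_id_eq_zero]
    refine colimit.hom_ext fun j => ?_
    have : IsZero ((D i).obj j) := by
      rw [← isZero_iff_sub]
      refine (subsingleton_iff (X := ModuleCat.of R (R ⧸ I ^ j.unop.unop)) i).2 ?_
      refine van (ModuleCat.of R (R ⧸ I ^ j.unop.unop)) j.unop.unop ?_ i hi
      exact (Ideal.annihilator_quotient (I := I ^ j.unop.unop)).ge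
    exact this.eq_of_src _ _
  · rw [← not_subsingleton_iff_nontrivial, isZero_iff_sub, (iso e).isZero_iff, ← isZero_iff_sub]
    intro hsub
    have hinj : ∀ j (f : op (op 1) ⟶ j), Function.Injective ((D e).map f).hom := by
      intro j f
      rw [← ModuleCat.mono_iff_injective]
      let g := (localCohomology.ringModIdeals (localCohomology.idealPowersDiagram I)).map f.unop
      have : Epi g := by
        rw [ModuleCat.epi_iff_surjective]
        intro y
        obtain ⟨y, rfl⟩ := Submodule.Quotient.mk_surjective _ y
        exact ⟨Submodule.Quotient.mk y, rfl⟩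
      refine old_ext_map_injective g (ModuleCat.of R M) e ?_
      refine new_ext_inj g e ?_
      have hnoe : IsNoetherian R (R ⧸ I ^ j.unop.unop) :=
        isNoetherian_of_isNoetherianRing_of_finite R _
      obtain ⟨h1, h2⟩ := @kernel_finite R _ (ModuleCat.of R (R ⧸ I ^ j.unop.unop)) _ g hnoe
      exact @van _ h1 j.unop.unop
        ((Ideal.annihilator_quotient (I := I ^ j.unop.unop)).ge.trans h2)
    have hz : Subsingleton ((D e).obj (op (op 1))) := by
      refine subsingleton_of_forall_eq 0 fun x => ?_
      have : PreservesColimit (D e) (forget (ModuleCat.{u} R)) := by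
        have : PreservesColimitsOfShape (ℕᵒᵖ)ᵒᵖ (forget (ModuleCat.{u} R)) := by
          have h1 : PreservesFilteredColimitsOfSize.{0, 0} (forget (ModuleCat.{u} R)) :=
            preservesFilteredColimitsOfSize_shrink.{0, u, 0, u} _
          exact h1.preserves_filtered_colimits _
        infer_instance
      obtain ⟨j, f, hf⟩ := Concrete.colimit_rep_eq_zero.{u, 0, 0} R (D e) _ x (Subsingleton.elim _ _)
      exact hinj j f (hf.trans (map_zero _).symm)
    have hz' : Subsingleton (Abelian.Ext (ModuleCat.of R (R ⧸ I ^ 1)) (ModuleCat.of R M) e) :=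
      (subsingleton_iff (X := ModuleCat.of R (R ⧸ I ^ 1)) e).1 hz
    obtain ⟨rs', hl, hm, hr⟩ := ModuleCat.exists_isRegular_of_exists_subsingleton_ext I (e + 1)
      (ModuleCat.of R M) (lt_top_iff_ne_top.2 hIM) (ModuleCat.of R (R ⧸ I ^ 1)) (by
        rw [Module.support_eq_zeroLocus, Ideal.annihilator_quotient, pow_one]) (by
        intro i hi
        rcases Nat.lt_succ_iff_lt_or_eq.1 hi with hi | rfl
        · exact van (ModuleCat.of R (R ⧸ I ^ 1)) 1 (Ideal.annihilator_quotient (I := I ^ 1)).ge i hi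
        · exact hz')
    have := hmax rs' hm hr
    omega
end DepthLC

/-- **depth sensitivity of local cohomology.** Let `R` be a commutative
Noetherian ring, `I` an ideal, `M` a finitely generated `R`-module with `IM ≠ M`, and
let `e = depth_I(M)` (the common length of maximal `M`-regular sequences in `I`,
expressed here by the existence of a regular sequence of length `e` in `I` together
with the maximality of `e`).  Then `H^i_I(M) = 0` for `i < e` and `H^e_I(M) ≠ 0`. -/
theorem stmt2 {R : Type u} [CommRing R] [IsNoetherianRing R]
    (I : Ideal R) (M : Type u) [AddCommGroup M] [Module R M] [Module.Finite R M]
    (hIM : I • (⊤ : Submodule R M) ≠ ⊤)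
    (e : ℕ)
    (hex : ∃ rs : List R, rs.length = e ∧ (∀ r ∈ rs, r ∈ I) ∧ IsRegular M rs)
    (hmax : ∀ rs : List R, (∀ r ∈ rs, r ∈ I) → IsRegular M rs → rs.length ≤ e) :
    (∀ i : ℕ, i < e →
        Subsingleton ((localCohomology I i).obj (ModuleCat.of R M))) ∧
      Nontrivial ((localCohomology I e).obj (ModuleCat.of R M)) := by
  exact DepthLC.depth_main I M hIM e hex hmax
end
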